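/- Let ℓ and m be distinct lines in Euclidean 3-space that meet in a point p, and let Π be the plane containing both ℓ and m. Let S₁ = S(c₁,r₁) and S₂ = S(c₂,r₂) be spheres with r₁, r₂ > 0 such that Π ∩ S₁ ≠ Π ∩ S₂ (as subsets of ℝ³) and such that the set of lines through p tangent to S₁ differs from the set of lines through p tangent to S₂. Then the set of lines that are tangent to both S₁ and S₂ and meet both ℓ and m is finite and has at most 8 elements. -/

import Mathlib

noncomputable section

/-- Euclidean 3-space. -/
abbrev E3 : Type := EuclideanSpace ℝ (Fin 3)

/-- A line in `ℝ³`: a 1-dimensional affine subspace. -/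
def IsLine (L : AffineSubspace ℝ E3) : Prop := Module.finrank ℝ L.direction = 1

/-- A plane in `ℝ³`: a 2-dimensional affine subspace. -/
def IsPlane (P : AffineSubspace ℝ E3) : Prop := Module.finrank ℝ P.direction = 2

/-- A line is tangent to the sphere with centre `c` and radius `r` if the distance
from `c` to the line equals `r`. -/
def Tangent (c : E3) (r : ℝ) (L : AffineSubspace ℝ E3) : Prop :=
  Metric.infDist c (L : Set E3) = r

/-- A line `L` meets a line `ℓ` if they have a common point. -/
def Meets (L ℓ : AffineSubspace ℝ E3) : Prop :=
  ((L : Set E3) ∩ (ℓ : Set E3)).Nonempty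

open scoped RealInnerProductSpace

/-- Any two vectors of `ℝ³` have a common unit normal. -/
lemma exists_unit_orthogonal_pair (a b : E3) :
    ∃ w : E3, ‖w‖ = 1 ∧ ⟪a, w⟫ = 0 ∧ ⟪b, w⟫ = 0 := by
  have hlt : Module.finrank ℝ (Submodule.span ℝ ({a, b} : Set E3)) < Module.finrank ℝ E3 := by
    classical
    have h := finrank_span_finset_le_card (R := ℝ) ({a, b} : Finset E3)
    have h2 := Finset.card_le_two (a := a) (b := b)
    rw [Set.finrank, Finset.coe_pair] at h
    rw [finrank_euclideanSpace_fin]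
    omega
  have hne : (Submodule.span ℝ ({a, b} : Set E3))ᗮ ≠ ⊥ := by
    intro h
    rw [Submodule.orthogonal_eq_bot_iff] at h
    rw [h, finrank_top] at hlt
    exact lt_irrefl _ hlt
  obtain ⟨w, hw, hw0⟩ := Submodule.exists_mem_ne_zero_of_ne_bot hne
  have ha := Submodule.inner_right_of_mem_orthogonal
    (Submodule.subset_span (by simp : a ∈ ({a, b} : Set E3))) hw
  have hb := Submodule.inner_right_of_mem_orthogonal
    (Submodule.subset_span (by simp : b ∈ ({a, b} : Set E3))) hw
  exact ⟨(‖w‖⁻¹ : ℝ) • w, norm_smul_inv_norm (𝕜 := ℝ) hw0, by simp [inner_smul_right, ha],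
    by simp [inner_smul_right, hb]⟩

/-- In `ℝ³` the common normals of two independent vectors are multiples of a single one. -/
lemma exists_smul_eq_of_orthogonal_pair {a b w y : E3} (hab : LinearIndependent ℝ ![a, b])
    (hw : w ≠ 0) (haw : ⟪a, w⟫ = 0) (hbw : ⟪b, w⟫ = 0) (hay : ⟪a, y⟫ = 0) (hby : ⟪b, y⟫ = 0) :
    ∃ t : ℝ, t • w = y := by
  set K : Submodule ℝ E3 := Submodule.span ℝ (Set.range ![a, b]) with hK
  have hmem : ∀ z : E3, ⟪a, z⟫ = 0 → ⟪b, z⟫ = 0 → z ∈ Kᗮ := by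
    intro z haz hbz
    have h : K ≤ (Submodule.span ℝ {z})ᗮ := by
      rw [hK, Submodule.span_le]
      rintro _ ⟨i, rfl⟩
      fin_cases i
      · exact Submodule.mem_orthogonal_singleton_iff_inner_left.2 haz
      · exact Submodule.mem_orthogonal_singleton_iff_inner_left.2 hbz
    exact Submodule.le_orthogonal_iff_le_orthogonal.1 h (Submodule.mem_span_singleton_self z)
  have hfin : Module.finrank ℝ Kᗮ = 1 := by
    have h := K.finrank_add_finrank_orthogonal
    rw [finrank_span_eq_card hab, finrank_euclideanSpace_fin, Fintype.card_fin] at h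
    omega
  obtain ⟨t, ht⟩ := (finrank_eq_one_iff_of_nonzero' (⟨w, hmem w haw hbw⟩ : Kᗮ)
    (by simpa using hw)).1 hfin ⟨y, hmem y hay hby⟩
  exact ⟨t, congrArg Subtype.val ht⟩

/-- A line meets the unit sphere of `ℝ³` in at most two points. -/
lemma encard_unit_inner_eq_le_two {a b : E3} (hab : LinearIndependent ℝ ![a, b]) (α β : ℝ) :
    {v : E3 | ‖v‖ = 1 ∧ ⟪a, v⟫ = α ∧ ⟪b, v⟫ = β}.encard ≤ 2 := by
  rcases Set.eq_empty_or_nonempty {v : E3 | ‖v‖ = 1 ∧ ⟪a, v⟫ = α ∧ ⟪b, v⟫ = β} with h | h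
  · simp [h]
  obtain ⟨v, hv, hva, hvb⟩ := h
  obtain ⟨w, hw, haw, hbw⟩ := exists_unit_orthogonal_pair a b
  refine (Set.encard_le_encard (t := {v, v + (-2 * ⟪v, w⟫) • w}) ?_).trans
    ((Set.encard_insert_le _ _).trans (by rw [Set.encard_singleton, one_add_one_eq_two]))
  rintro y ⟨hy, hya, hyb⟩
  obtain ⟨t, ht⟩ := exists_smul_eq_of_orthogonal_pair (y := y - v) hab
    (by rintro rfl; simp at hw) haw hbw
    (by rw [inner_sub_right, hya, hva, sub_self]) (by rw [inner_sub_right, hyb, hvb, sub_self])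
  obtain rfl : y = v + t • w := by rw [ht]; abel
  have h := norm_add_sq_real v (t • w)
  rw [hy, hv, norm_smul, hw, inner_smul_right, Real.norm_eq_abs, mul_one, sq_abs] at h
  have h' : t * (t - -2 * ⟪v, w⟫) = 0 := by linarith
  rcases mul_eq_zero.1 h' with h' | h'
  · simp [h']
  · simp [sub_eq_zero.1 h']

/-- The distance from a point to a set is realised by the foot of a perpendicular. -/
lemma infDist_eq_dist_of_orthogonal {c q : E3} {s : Set E3} (hq : q ∈ s)
    (h : ∀ x ∈ s, ⟪c - q, x - q⟫ = 0) : Metric.infDist c s = dist c q := by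
  refine le_antisymm (Metric.infDist_le_dist_of_mem hq) ?_
  refine (Metric.le_infDist ⟨q, hq⟩).2 fun {x} hx => ?_
  rw [dist_eq_norm, dist_eq_norm]
  refine le_of_sq_le_sq ?_ (norm_nonneg _)
  have h1 := norm_sub_sq_real (c - q) (x - q)
  rw [h x hx, sub_sub_sub_cancel_right] at h1
  nlinarith [sq_nonneg ‖x - q‖]

lemma exists_unit_eq_mk' {L : AffineSubspace ℝ E3} (hL : IsLine L) {p : E3} (hp : p ∈ L) :
    ∃ v : E3, ‖v‖ = 1 ∧ L = AffineSubspace.mk' p (Submodule.span ℝ {v}) := by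
  obtain ⟨w, hw, hspan⟩ := finrank_eq_one_iff'.1 hL
  have hw0 : (w : E3) ≠ 0 := by simpa using hw
  refine ⟨(‖(w : E3)‖⁻¹ : ℝ) • (w : E3), norm_smul_inv_norm (𝕜 := ℝ) hw0, ?_⟩
  rw [Submodule.span_singleton_smul_eq (IsUnit.mk0 _ (inv_ne_zero (norm_ne_zero_iff.2 hw0)))]
  have hd : L.direction = Submodule.span ℝ {(w : E3)} := by
    refine le_antisymm (fun y hy => ?_) ?_
    · obtain ⟨t, ht⟩ := hspan ⟨y, hy⟩
      exact Submodule.mem_span_singleton.2 ⟨t, congrArg Subtype.val ht⟩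
    · rw [Submodule.span_singleton_le_iff_mem]
      exact w.2
  rw [← hd, AffineSubspace.mk'_eq hp]

lemma IsLine.nonempty {L : AffineSubspace ℝ E3} (hL : IsLine L) : (L : Set E3).Nonempty := by
  rw [AffineSubspace.nonempty_iff_ne_bot]
  rintro rfl
  rw [IsLine, AffineSubspace.direction_bot, finrank_bot] at hL
  exact zero_ne_one hL

/-- A line is spanned by any two of its points. -/
lemma IsLine.eq_affineSpan_pair {L : AffineSubspace ℝ E3} (hL : IsLine L) {x y : E3}
    (hx : x ∈ L) (hy : y ∈ L) (hxy : x ≠ y) : L = line[ℝ, x, y] := by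
  symm
  have hle := affineSpan_pair_le_of_mem_of_mem hx hy
  refine AffineSubspace.eq_of_direction_eq_of_nonempty_of_le ?_
    ⟨x, left_mem_affineSpan_pair ℝ x y⟩ hle
  refine Submodule.eq_of_le_of_finrank_eq (AffineSubspace.direction_le hle) ?_
  rw [show Module.finrank ℝ L.direction = 1 from hL, direction_affineSpan,
    vectorSpan_pair, finrank_span_singleton]
  simpa [sub_eq_zero] using hxy

lemma tangent_mk'_iff {c p v : E3} {r : ℝ} (hr : 0 < r) (hv : ‖v‖ = 1) :
    Tangent c r (AffineSubspace.mk' p (Submodule.span ℝ {v})) ↔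
      ⟪c - p, v⟫ ^ 2 = ‖c - p‖ ^ 2 - r ^ 2 := by
  have hvv : ⟪v, v⟫ = 1 := by rw [real_inner_self_eq_norm_sq, hv, one_pow]
  rw [Tangent, infDist_eq_dist_of_orthogonal (q := p + ⟪c - p, v⟫ • v), dist_eq_norm,
    ← sq_eq_sq₀ (norm_nonneg _) hr.le, ← sub_sub, norm_sub_sq_real, inner_smul_right, norm_smul,
    hv, mul_one, Real.norm_eq_abs, sq_abs]
  · constructor <;> intro h <;> linarith
  · simp [AffineSubspace.mem_mk', Submodule.mem_span_singleton]
  · intro x hx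
    obtain ⟨t, ht⟩ := Submodule.mem_span_singleton.1 (AffineSubspace.mem_mk'.1 hx)
    rw [vsub_eq_sub] at ht
    rw [← sub_sub, ← sub_sub, ← ht]
    simp only [inner_sub_left, inner_sub_right, inner_smul_left, inner_smul_right, hvv,
      RCLike.conj_to_real]
    ring

/-- Two different tangent cones with a common apex share at most four lines. -/
lemma encard_common_tangents_through_le_four {p c₁ c₂ : E3} {r₁ r₂ : ℝ} (hr₁ : 0 < r₁)
    (hr₂ : 0 < r₂)
    (hcone : {L : AffineSubspace ℝ E3 | IsLine L ∧ p ∈ L ∧ Tangent c₁ r₁ L} ≠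
             {L : AffineSubspace ℝ E3 | IsLine L ∧ p ∈ L ∧ Tangent c₂ r₂ L}) :
    {L : AffineSubspace ℝ E3 | IsLine L ∧ p ∈ L ∧ Tangent c₁ r₁ L ∧ Tangent c₂ r₂ L}.encard
      ≤ 4 := by
  rcases Set.eq_empty_or_nonempty {L : AffineSubspace ℝ E3 |
    IsLine L ∧ p ∈ L ∧ Tangent c₁ r₁ L ∧ Tangent c₂ r₂ L} with h | h
  · simp [h]
  obtain ⟨L₀, hL₀, hpL₀, hT₁, hT₂⟩ := h
  obtain ⟨v₀, hv₀, rfl⟩ := exists_unit_eq_mk' hL₀ hpL₀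
  rw [tangent_mk'_iff hr₁ hv₀] at hT₁
  rw [tangent_mk'_iff hr₂ hv₀] at hT₂
  have hind : LinearIndependent ℝ ![c₁ - p, c₂ - p] := by
    have hne : ∀ {c : E3} {r : ℝ}, 0 < r → ⟪c - p, v₀⟫ ^ 2 = ‖c - p‖ ^ 2 - r ^ 2 →
        c - p ≠ 0 := by
      intro c r hr h h0
      rw [h0, norm_zero] at h
      nlinarith [sq_nonneg ⟪(0 : E3), v₀⟫, pow_pos hr 2]
    rw [LinearIndependent.pair_iff' (hne hr₁ hT₁)]
    intro t ht
    have ht0 : t ≠ 0 := by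
      rintro rfl
      rw [zero_smul] at ht
      exact hne hr₂ hT₂ ht.symm
    refine hcone (Set.ext fun L => and_congr_right fun hL => and_congr_right fun hp => ?_)
    obtain ⟨v, hv, rfl⟩ := exists_unit_eq_mk' hL hp
    rw [tangent_mk'_iff hr₁ hv, tangent_mk'_iff hr₂ hv, ← hT₁, ← hT₂, ← ht]
    simp only [inner_smul_left, RCLike.conj_to_real, mul_pow]
    exact (mul_right_inj' (pow_ne_zero 2 ht0)).symm
  set N : ℝ → Set E3 := fun β => {v : E3 | ‖v‖ = 1 ∧ ⟪c₁ - p, v⟫ = ⟪c₁ - p, v₀⟫ ∧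
    ⟪c₂ - p, v⟫ = β}
  have hsub : {L : AffineSubspace ℝ E3 |
      IsLine L ∧ p ∈ L ∧ Tangent c₁ r₁ L ∧ Tangent c₂ r₂ L} ⊆
      (fun v : E3 => AffineSubspace.mk' p (Submodule.span ℝ {v})) ''
        (N ⟪c₂ - p, v₀⟫ ∪ N (-⟪c₂ - p, v₀⟫)) := by
    rintro L ⟨hL, hp, h₁, h₂⟩
    obtain ⟨v, hv, rfl⟩ := exists_unit_eq_mk' hL hp
    rw [tangent_mk'_iff hr₁ hv, ← hT₁, sq_eq_sq_iff_eq_or_eq_neg] at h₁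
    rw [tangent_mk'_iff hr₂ hv, ← hT₂, sq_eq_sq_iff_eq_or_eq_neg] at h₂
    rcases h₁ with h₁ | h₁
    · exact ⟨v, h₂.imp (fun h => ⟨hv, h₁, h⟩) (fun h => ⟨hv, h₁, h⟩), rfl⟩
    · refine ⟨-v, h₂.symm.imp (fun h => ⟨by rwa [norm_neg], ?_, ?_⟩)
        (fun h => ⟨by rwa [norm_neg], ?_, ?_⟩), ?_⟩
      · rw [inner_neg_right, h₁, neg_neg]
      · rw [inner_neg_right, h, neg_neg]
      · rw [inner_neg_right, h₁, neg_neg]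
      · rw [inner_neg_right, h]
      · simp only [← Set.neg_singleton, Submodule.span_neg]
  calc _ ≤ _ := Set.encard_le_encard hsub
    _ ≤ _ := Set.encard_image_le _ _
    _ ≤ _ := Set.encard_union_le _ _
    _ ≤ 2 + 2 := add_le_add (encard_unit_inner_eq_le_two hind _ _)
        (encard_unit_inner_eq_le_two hind _ _)
    _ = 4 := by norm_num

/-- A line lying in a plane with unit normal `u` is cut out of it by a second unit normal. -/
lemma exists_normal_equation {L : AffineSubspace ℝ E3} (hL : IsLine L) {p u : E3} (hu : ‖u‖ = 1)
    (hLu : ∀ x ∈ L, ⟪u, x - p⟫ = 0) :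
    ∃ (n : E3) (h : ℝ), ‖n‖ = 1 ∧ ⟪u, n⟫ = 0 ∧
      (L : Set E3) = {x | ⟪u, x - p⟫ = 0 ∧ ⟪n, x - p⟫ = h} := by
  obtain ⟨x₀, hx₀⟩ := hL.nonempty
  obtain ⟨v, hv, rfl⟩ := exists_unit_eq_mk' hL hx₀
  obtain ⟨n, hn, hun, hvn⟩ := exists_unit_orthogonal_pair u v
  have huv : ⟪u, v⟫ = 0 := by
    have h := hLu (v + x₀) (by simp [AffineSubspace.mem_mk', Submodule.mem_span_singleton_self])
    rwa [add_sub_assoc, inner_add_right, hLu x₀ hx₀, add_zero] at h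
  have hind : LinearIndependent ℝ ![u, n] := by
    rw [LinearIndependent.pair_iff' (by rintro rfl; simp at hu)]
    rintro t rfl
    rw [inner_smul_right, real_inner_self_eq_norm_sq, hu, one_pow, mul_one] at hun
    simp [hun] at hn
  rw [real_inner_comm] at hvn
  refine ⟨n, ⟪n, x₀ - p⟫, hn, hun, Set.ext fun x => ⟨fun hx => ⟨hLu x hx, ?_⟩, ?_⟩⟩
  · obtain ⟨t, ht⟩ := Submodule.mem_span_singleton.1 (AffineSubspace.mem_mk'.1 hx)
    rw [vsub_eq_sub] at ht
    rw [← sub_add_sub_cancel x x₀ p, ← ht, inner_add_right, inner_smul_right, hvn, mul_zero,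
      zero_add]
  · rintro ⟨h₁, h₂⟩
    refine AffineSubspace.mem_mk'.2 (Submodule.mem_span_singleton.2 ?_)
    rw [vsub_eq_sub, ← sub_sub_sub_cancel_right x x₀ p]
    refine exists_smul_eq_of_orthogonal_pair hind (by rintro rfl; simp at hv) huv hvn ?_ ?_
    · rw [inner_sub_right, h₁, hLu x₀ hx₀, sub_zero]
    · rw [inner_sub_right, h₂, sub_self]

lemma tangent_iff_of_normal_equation {L : AffineSubspace ℝ E3} {c p u n : E3} {r h : ℝ}
    (hr : 0 < r) (hu : ‖u‖ = 1) (hn : ‖n‖ = 1) (hun : ⟪u, n⟫ = 0)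
    (hL : (L : Set E3) = {x | ⟪u, x - p⟫ = 0 ∧ ⟪n, x - p⟫ = h}) :
    Tangent c r L ↔ (⟪n, c - p⟫ - h) ^ 2 = r ^ 2 - ⟪u, c - p⟫ ^ 2 := by
  have huu : ⟪u, u⟫ = 1 := by rw [real_inner_self_eq_norm_sq, hu, one_pow]
  have hnn : ⟪n, n⟫ = 1 := by rw [real_inner_self_eq_norm_sq, hn, one_pow]
  have hnu : ⟪n, u⟫ = 0 := by rwa [real_inner_comm]
  set q : E3 := c - (⟪u, c - p⟫ • u + (⟪n, c - p⟫ - h) • n) with hq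
  have hqp : q - p = (c - p) - (⟪u, c - p⟫ • u + (⟪n, c - p⟫ - h) • n) := by rw [hq]; abel
  have hcq : c - q = ⟪u, c - p⟫ • u + (⟪n, c - p⟫ - h) • n := by rw [hq]; abel
  have huq : ⟪u, q - p⟫ = 0 := by
    rw [hqp, inner_sub_right, inner_add_right, inner_smul_right, inner_smul_right, huu, hun]
    ring
  have hnq : ⟪n, q - p⟫ = h := by
    rw [hqp, inner_sub_right, inner_add_right, inner_smul_right, inner_smul_right, hnn, hnu]
    ring
  rw [Tangent, hL, infDist_eq_dist_of_orthogonal (q := q) (Set.mem_ofPred_eq ▸ ⟨huq, hnq⟩), dist_eq_norm,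
    ← sq_eq_sq₀ (norm_nonneg _) hr.le, hcq, norm_add_sq_real, norm_smul, norm_smul, hu, hn,
    inner_smul_left, inner_smul_right, hun, mul_one, mul_one, Real.norm_eq_abs, sq_abs,
    Real.norm_eq_abs, sq_abs]
  · constructor <;> intro h <;> linarith
  · rintro x ⟨h₁, h₂⟩
    rw [hcq, ← sub_sub_sub_cancel_right x q p, inner_add_left, inner_smul_left, inner_smul_left,
      inner_sub_right u (x - p), inner_sub_right n (x - p), h₁, h₂, huq, hnq]
    simp

/-- Two spheres cutting a plane in different sets have at most four common tangents in it. -/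
lemma encard_common_tangents_in_plane_le_four {P : AffineSubspace ℝ E3} (hP : IsPlane P)
    {p : E3} (hp : p ∈ P) {c₁ c₂ : E3} {r₁ r₂ : ℝ} (hr₁ : 0 < r₁) (hr₂ : 0 < r₂)
    (hplane : (P : Set E3) ∩ Metric.sphere c₁ r₁ ≠ (P : Set E3) ∩ Metric.sphere c₂ r₂) :
    {L : AffineSubspace ℝ E3 | IsLine L ∧ L ≤ P ∧ Tangent c₁ r₁ L ∧ Tangent c₂ r₂ L}.encard
      ≤ 4 := by
  obtain ⟨u, hu, hPu⟩ : ∃ u : E3, ‖u‖ = 1 ∧ ∀ x ∈ P, ⟪u, x - p⟫ = 0 := by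
    have hne : P.directionᗮ ≠ ⊥ := by
      intro h
      rw [Submodule.orthogonal_eq_bot_iff] at h
      rw [IsPlane, h, finrank_top, finrank_euclideanSpace_fin] at hP
      omega
    obtain ⟨w, hw, hw0⟩ := Submodule.exists_mem_ne_zero_of_ne_bot hne
    refine ⟨(‖w‖⁻¹ : ℝ) • w, norm_smul_inv_norm (𝕜 := ℝ) hw0, fun x hx => ?_⟩
    have h := Submodule.inner_left_of_mem_orthogonal
      (AffineSubspace.vsub_mem_direction hx hp) hw
    rw [vsub_eq_sub] at h
    rw [inner_smul_left, h, mul_zero]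
  have hrep : ∀ L : AffineSubspace ℝ E3, IsLine L → L ≤ P → Tangent c₁ r₁ L →
      Tangent c₂ r₂ L → ∃ (n : E3) (h : ℝ), ‖n‖ = 1 ∧ ⟪u, n⟫ = 0 ∧
        (L : Set E3) = {x | ⟪u, x - p⟫ = 0 ∧ ⟪n, x - p⟫ = h} ∧
        (⟪n, c₁ - p⟫ - h) ^ 2 = r₁ ^ 2 - ⟪u, c₁ - p⟫ ^ 2 ∧
        (⟪n, c₂ - p⟫ - h) ^ 2 = r₂ ^ 2 - ⟪u, c₂ - p⟫ ^ 2 := by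
    intro L hL hLP h₁ h₂
    obtain ⟨n, h, hn, hun, hLn⟩ := exists_normal_equation hL hu fun x hx => hPu x (hLP hx)
    exact ⟨n, h, hn, hun, hLn, (tangent_iff_of_normal_equation hr₁ hu hn hun hLn).1 h₁,
      (tangent_iff_of_normal_equation hr₂ hu hn hun hLn).1 h₂⟩
  rcases Set.eq_empty_or_nonempty {L : AffineSubspace ℝ E3 |
    IsLine L ∧ L ≤ P ∧ Tangent c₁ r₁ L ∧ Tangent c₂ r₂ L} with hE | hE
  · simp [hE]
  obtain ⟨L₀, hL₀, hL₀P, hT₁, hT₂⟩ := hE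
  obtain ⟨n₀, h₀, -, hun₀, -, hk₁, hk₂⟩ := hrep L₀ hL₀ hL₀P hT₁ hT₂
  have hind : LinearIndependent ℝ ![u, c₁ - c₂] := by
    rw [LinearIndependent.pair_iff' (by rintro rfl; simp at hu)]
    intro t ht
    have hc : c₁ = c₂ + t • u := by rw [ht]; abel
    have hn : ⟪n₀, c₁ - p⟫ = ⟪n₀, c₂ - p⟫ := by
      rw [hc, add_sub_right_comm, inner_add_right, inner_smul_right, real_inner_comm u n₀, hun₀]
      ring
    have hu' : ⟪u, c₁ - p⟫ = ⟪u, c₂ - p⟫ + t := by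
      rw [hc, add_sub_right_comm, inner_add_right, inner_smul_right, real_inner_self_eq_norm_sq,
        hu]
      ring
    refine hplane (Set.ext fun x => and_congr_right fun hx => ?_)
    have hx' : ⟪x - c₂, u⟫ = -⟪u, c₂ - p⟫ := by
      rw [real_inner_comm, ← sub_sub_sub_cancel_right x c₂ p, inner_sub_right, hPu x hx, zero_sub]
    have hd : ‖x - c₁‖ ^ 2 = ‖x - c₂‖ ^ 2 + 2 * t * ⟪u, c₂ - p⟫ + t ^ 2 := by
      rw [hc, ← sub_sub, norm_sub_sq_real, norm_smul, hu, inner_smul_right, hx', mul_one,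
        Real.norm_eq_abs, sq_abs]
      ring
    rw [mem_sphere_iff_norm, mem_sphere_iff_norm, ← sq_eq_sq₀ (norm_nonneg _) hr₁.le,
      ← sq_eq_sq₀ (norm_nonneg _) hr₂.le, hd]
    rw [hn, hk₂, hu'] at hk₁
    constructor <;> intro h <;> linarith
  set s₁ : ℝ := ⟪n₀, c₁ - p⟫ - h₀ with hs₁
  set s₂ : ℝ := ⟪n₀, c₂ - p⟫ - h₀ with hs₂
  set N : ℝ → Set E3 := fun β => {n : E3 | ‖n‖ = 1 ∧ ⟪u, n⟫ = 0 ∧ ⟪c₁ - c₂, n⟫ = β}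
  have hsub : ((↑) : AffineSubspace ℝ E3 → Set E3) '' {L : AffineSubspace ℝ E3 |
      IsLine L ∧ L ≤ P ∧ Tangent c₁ r₁ L ∧ Tangent c₂ r₂ L} ⊆
      (fun n : E3 => {x : E3 | ⟪u, x - p⟫ = 0 ∧ ⟪n, x - p⟫ = ⟪n, c₁ - p⟫ - s₁}) ''
        (N (s₁ - s₂) ∪ N (s₁ + s₂)) := by
    rintro _ ⟨L, ⟨hL, hLP, h₁, h₂⟩, rfl⟩
    obtain ⟨n, h, hn, hun, hLn, h₁, h₂⟩ := hrep L hL hLP h₁ h₂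
    rw [← hk₁, sq_eq_sq_iff_eq_or_eq_neg] at h₁
    rw [← hk₂, sq_eq_sq_iff_eq_or_eq_neg] at h₂
    have hw : ⟪c₁ - c₂, n⟫ = ⟪n, c₁ - p⟫ - ⟪n, c₂ - p⟫ := by
      rw [real_inner_comm, ← inner_sub_right, sub_sub_sub_cancel_right]
    rcases h₁ with h₁ | h₁
    · refine ⟨n, h₂.imp (fun h₂ => ⟨hn, hun, ?_⟩) (fun h₂ => ⟨hn, hun, ?_⟩), ?_⟩
      · linarith
      · linarith
      · rw [hLn, ← h₁]
        simp
    · refine ⟨-n, h₂.symm.imp (fun h₂ => ⟨by rwa [norm_neg], by simp [hun], ?_⟩)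
        (fun h₂ => ⟨by rwa [norm_neg], by simp [hun], ?_⟩), ?_⟩
      · rw [inner_neg_right]; linarith
      · rw [inner_neg_right]; linarith
      · rw [hLn]
        ext x
        simp only [inner_neg_left, Set.mem_ofPred_eq]
        refine and_congr_right fun _ => ⟨fun h => ?_, fun h => ?_⟩ <;> linarith
  calc _ = _ := (SetLike.coe_injective.encard_image _).symm
    _ ≤ _ := Set.encard_le_encard hsub
    _ ≤ _ := Set.encard_image_le _ _
    _ ≤ _ := Set.encard_union_le _ _
    _ ≤ 2 + 2 := add_le_add (encard_unit_inner_eq_le_two hind _ _)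
        (encard_unit_inner_eq_le_two hind _ _)
    _ = 4 := by norm_num

/-- If `ℓ` and `m` are distinct lines meeting at `p`, spanning the plane `P`, and two
spheres cut `P` in different sets and have distinct tangent cones at `p`, then there
are at most eight lines tangent to both spheres that meet both `ℓ` and `m`. -/
theorem common_tangents_meeting_two_lines
    (ℓ m : AffineSubspace ℝ E3) (hℓ : IsLine ℓ) (hm : IsLine m) (hlm : ℓ ≠ m)
    (p : E3) (hpℓ : p ∈ ℓ) (hpm : p ∈ m)
    (P : AffineSubspace ℝ E3) (hP : IsPlane P)
    (hℓP : (ℓ : Set E3) ⊆ (P : Set E3)) (hmP : (m : Set E3) ⊆ (P : Set E3))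
    (c₁ c₂ : E3) (r₁ r₂ : ℝ) (hr₁ : 0 < r₁) (hr₂ : 0 < r₂)
    (hplane : (P : Set E3) ∩ Metric.sphere c₁ r₁ ≠ (P : Set E3) ∩ Metric.sphere c₂ r₂)
    (hcone : {L : AffineSubspace ℝ E3 | IsLine L ∧ p ∈ L ∧ Tangent c₁ r₁ L} ≠
             {L : AffineSubspace ℝ E3 | IsLine L ∧ p ∈ L ∧ Tangent c₂ r₂ L}) :
    {L : AffineSubspace ℝ E3 | IsLine L ∧ Tangent c₁ r₁ L ∧ Tangent c₂ r₂ L ∧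
        Meets L ℓ ∧ Meets L m}.Finite ∧
    {L : AffineSubspace ℝ E3 | IsLine L ∧ Tangent c₁ r₁ L ∧ Tangent c₂ r₂ L ∧
        Meets L ℓ ∧ Meets L m}.ncard ≤ 8 := by
  have hsub : {L : AffineSubspace ℝ E3 | IsLine L ∧ Tangent c₁ r₁ L ∧ Tangent c₂ r₂ L ∧
      Meets L ℓ ∧ Meets L m} ⊆
      {L : AffineSubspace ℝ E3 | IsLine L ∧ p ∈ L ∧ Tangent c₁ r₁ L ∧ Tangent c₂ r₂ L} ∪
      {L : AffineSubspace ℝ E3 | IsLine L ∧ L ≤ P ∧ Tangent c₁ r₁ L ∧ Tangent c₂ r₂ L} := by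
    rintro L ⟨hL, h₁, h₂, ⟨x, hxL, hxℓ⟩, ⟨y, hyL, hym⟩⟩
    by_cases hpL : p ∈ L
    · exact Or.inl ⟨hL, hpL, h₁, h₂⟩
    · refine Or.inr ⟨hL, ?_, h₁, h₂⟩
      have hxy : x ≠ y := by
        rintro rfl
        have hpx : p ≠ x := fun h => hpL (h ▸ hxL)
        exact hlm ((hℓ.eq_affineSpan_pair hpℓ hxℓ hpx).trans
          (hm.eq_affineSpan_pair hpm hym hpx).symm)
      rw [hL.eq_affineSpan_pair hxL hyL hxy]
      exact affineSpan_pair_le_of_mem_of_mem (hℓP hxℓ) (hmP hym)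
  have hle : {L : AffineSubspace ℝ E3 | IsLine L ∧ Tangent c₁ r₁ L ∧ Tangent c₂ r₂ L ∧
      Meets L ℓ ∧ Meets L m}.encard ≤ (8 : ℕ) :=
    calc _ ≤ _ := Set.encard_le_encard hsub
      _ ≤ _ := Set.encard_union_le _ _
      _ ≤ 4 + 4 := add_le_add (encard_common_tangents_through_le_four hr₁ hr₂ hcone)
          (encard_common_tangents_in_plane_le_four hP (hℓP hpℓ) hr₁ hr₂ hplane)
      _ = (8 : ℕ) := by norm_num
  have hfin := Set.finite_of_encard_le_coe hle
  refine ⟨hfin, ?_⟩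
  rw [← hfin.cast_ncard_eq] at hle
  exact_mod_cast hle
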